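/- Suppose w: S² → ℝ is a smooth solution of Δ_{g₀} w = 6 - 6e^w on the round sphere. Then there is a universal constant ε₀ > 0 such that if |w|_{C⁰} < ε₀, then w ≡ 0. -/

import Mathlib

open Real

/-- The Laplace–Beltrami operator on the unit sphere `S² ⊂ ℝ³`, computed via
the degree-zero homogeneous extension: for `x` on the unit sphere,
`Δ_{S²} w (x) = Δ_{ℝ³} W (x)` where `W(y) = w(y/‖y‖)`. -/
noncomputable def sphereLaplacian (w : EuclideanSpace ℝ (Fin 3) → ℝ)
    (x : EuclideanSpace ℝ (Fin 3)) : ℝ :=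
  ∑ i : Fin 3, iteratedFDeriv ℝ 2 (fun y => w (‖y‖⁻¹ • y)) x
    ![EuclideanSpace.single i 1, EuclideanSpace.single i 1]

open MeasureTheory

lemma hasDerivAt_intervalIntegral_param {g g' : ℝ → ℝ → ℝ}
    (hg : Continuous (Function.uncurry g)) (hg' : Continuous (Function.uncurry g'))
    (h : ∀ r θ, HasDerivAt (fun r => g r θ) (g' r θ) r) (a b r : ℝ) :
    HasDerivAt (fun r => ∫ θ in a..b, g r θ) (∫ θ in a..b, g' r θ) r := by
  obtain ⟨C, hC⟩ := ((isCompact_Icc (a := r - 1) (b := r + 1)).prod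
    (isCompact_uIcc (a := a) (b := b))).exists_bound_of_continuousOn hg'.continuousOn
  have hcont : ∀ r, Continuous (g r) := fun r => hg.comp (by fun_prop : Continuous fun θ => (r, θ))
  have hcont' : ∀ r, Continuous (g' r) :=
    fun r => hg'.comp (by fun_prop : Continuous fun θ => (r, θ))
  refine (intervalIntegral.hasDerivAt_integral_of_dominated_loc_of_deriv_le
    (Icc_mem_nhds (by linarith : r - 1 < r) (by linarith : r < r + 1))
    (Filter.Eventually.of_forall fun r => (hcont r).aestronglyMeasurable)
    ((hcont r).intervalIntegrable _ _) (hcont' r).aestronglyMeasurable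
    (bound := fun _ => C) ?_ (by simp) ?_).2
  · exact Filter.Eventually.of_forall fun θ hθ x hx =>
      hC (x, θ) ⟨hx, Set.uIoc_subset_uIcc hθ⟩
  · exact Filter.Eventually.of_forall fun θ _ x _ => h x θ

/-- Spherical coordinates about the pole `b 2`. -/
noncomputable def spherePoint {E : Type*} [NormedAddCommGroup E] [InnerProductSpace ℝ E]
    (b : OrthonormalBasis (Fin 3) ℝ E) (r θ : ℝ) : E :=
  cos r • b 2 + sin r • (cos θ • b 0 + sin θ • b 1)

section
variable {E : Type*} [NormedAddCommGroup E] [InnerProductSpace ℝ E]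

lemma orthonormalBasis_inner (b : OrthonormalBasis (Fin 3) ℝ E) (i j : Fin 3) :
    inner ℝ (b i) (b j) = if i = j then 1 else 0 :=
  orthonormal_iff_ite.1 b.orthonormal i j

lemma norm_spherePoint (b : OrthonormalBasis (Fin 3) ℝ E) (r θ : ℝ) :
    ‖spherePoint b r θ‖ = 1 := by
  have : inner ℝ (spherePoint b r θ) (spherePoint b r θ) = (1 : ℝ) := by
    simp [-inner_self_eq_norm_sq_to_K, spherePoint, inner_add_left, inner_add_right,
      real_inner_smul_left, real_inner_smul_right, orthonormalBasis_inner]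
    nlinarith [sin_sq_add_cos_sq r, sin_sq_add_cos_sq θ]
  rw [real_inner_self_eq_norm_sq] at this
  nlinarith [norm_nonneg (spherePoint b r θ)]

lemma spherePoint_ne_zero (b : OrthonormalBasis (Fin 3) ℝ E) (r θ : ℝ) :
    spherePoint b r θ ≠ 0 := by
  rw [← norm_ne_zero_iff, norm_spherePoint]; exact one_ne_zero

lemma continuous_spherePoint (b : OrthonormalBasis (Fin 3) ℝ E) :
    Continuous (Function.uncurry (spherePoint b)) := by
  unfold spherePoint Function.uncurry
  fun_prop

lemma OrthonormalBasis.exists_coe_eq {ι : Type*} [Fintype ι] [Nonempty ι]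
    (b : OrthonormalBasis ι ℝ E) {v : ι → E} (hv : Orthonormal ℝ v) :
    ∃ c : OrthonormalBasis ι ℝ E, ⇑c = v := by
  have hcard : Fintype.card ι = Module.finrank ℝ E := by
    rw [Module.finrank_eq_card_basis b.toBasis]
  have h := coe_basisOfOrthonormalOfCardEqFinrank hv hcard
  exact ⟨(basisOfOrthonormalOfCardEqFinrank hv hcard).toOrthonormalBasis (by rwa [h]), by
    rw [Module.Basis.coe_toOrthonormalBasis, h]⟩

/-- The unit tangent vector to the meridians of spherical coordinates. -/
noncomputable def sphereMeridian (b : OrthonormalBasis (Fin 3) ℝ E) (r θ : ℝ) : E :=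
  -sin r • b 2 + cos r • (cos θ • b 0 + sin θ • b 1)

/-- The unit tangent vector to the parallels of spherical coordinates. -/
noncomputable def sphereParallel (b : OrthonormalBasis (Fin 3) ℝ E) (θ : ℝ) : E :=
  -sin θ • b 0 + cos θ • b 1

/-- The orthonormal frame attached to spherical coordinates. -/
lemma exists_sphericalFrame (b : OrthonormalBasis (Fin 3) ℝ E) (r θ : ℝ) :
    ∃ c : OrthonormalBasis (Fin 3) ℝ E, c 0 = spherePoint b r θ ∧
      c 1 = sphereMeridian b r θ ∧ c 2 = sphereParallel b θ := by
  let v : Fin 3 → E := ![spherePoint b r θ, sphereMeridian b r θ, sphereParallel b θ]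
  have hr := sin_sq_add_cos_sq r
  have hθ := sin_sq_add_cos_sq θ
  have hv : Orthonormal ℝ v := by
    rw [orthonormal_iff_ite]
    intro i j
    fin_cases i <;> fin_cases j <;>
      simp [-inner_self_eq_norm_sq_to_K, v, spherePoint, sphereMeridian,
        sphereParallel, inner_add_left, inner_add_right, real_inner_smul_left,
        real_inner_smul_right, orthonormalBasis_inner] <;> grind
  obtain ⟨c, hc⟩ := b.exists_coe_eq hv
  exact ⟨c, by rw [hc]; rfl, by rw [hc]; rfl, by rw [hc]; rfl⟩
end

section
variable {E : Type*} [NormedAddCommGroup E] [InnerProductSpace ℝ E]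

lemma fderiv_apply_self_of_homogeneous {W : E → ℝ} (hom : ∀ t : ℝ, 0 < t → ∀ y, W (t • y) = W y)
    {y : E} (hW : DifferentiableAt ℝ W y) : fderiv ℝ W y y = 0 := by
  have h1 : HasDerivAt (fun t : ℝ => t • y) y 1 := by
    simpa using (hasDerivAt_id (1 : ℝ)).smul_const y
  have h2 : HasDerivAt (fun t : ℝ => W (t • y)) (fderiv ℝ W y y) 1 :=
    HasFDerivAt.comp_hasDerivAt 1 (by simpa using hW.hasFDerivAt) h1
  have h3 : HasDerivAt (fun t : ℝ => W (t • y)) 0 1 := by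
    refine (hasDerivAt_const (1 : ℝ) (W y)).congr_of_eventuallyEq ?_
    filter_upwards [lt_mem_nhds (zero_lt_one : (0 : ℝ) < 1)] with t ht using hom t ht y
  exact h2.unique h3

lemma fderiv_fderiv_apply_self_of_homogeneous {W : E → ℝ}
    (hom : ∀ t : ℝ, 0 < t → ∀ y, W (t • y) = W y)
    (hW : ∀ y, y ≠ 0 → DifferentiableAt ℝ W y) {y : E} (hy : y ≠ 0)
    (hW' : DifferentiableAt ℝ (fderiv ℝ W) y) : fderiv ℝ (fderiv ℝ W) y y y = 0 := by
  have h1 : HasDerivAt (fun t : ℝ => t • y) y 1 := by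
    simpa using (hasDerivAt_id (1 : ℝ)).smul_const y
  have h2 : HasDerivAt (fun t : ℝ => fderiv ℝ W (t • y)) (fderiv ℝ (fderiv ℝ W) y y) 1 :=
    HasFDerivAt.comp_hasDerivAt 1 (by simpa using hW'.hasFDerivAt) h1
  have h3 : HasDerivAt (fun t : ℝ => fderiv ℝ W (t • y) y)
      (fderiv ℝ (fderiv ℝ W) y y y) 1 := by
    simpa using h2.clm_apply (hasDerivAt_const (1 : ℝ) y)
  have h4 : HasDerivAt (fun t : ℝ => fderiv ℝ W (t • y) y) 0 1 := by
    refine (hasDerivAt_const (1 : ℝ) (0 : ℝ)).congr_of_eventuallyEq ?_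
    filter_upwards [lt_mem_nhds (zero_lt_one : (0 : ℝ) < 1)] with t ht
    have h := fderiv_apply_self_of_homogeneous hom (hW (t • y) (smul_ne_zero ht.ne' hy))
    rw [map_smul, smul_eq_mul] at h
    exact (mul_eq_zero.1 h).resolve_left ht.ne'
  exact h3.unique h4

/-- The trace of the second derivative in an orthonormal basis is the Laplacian. -/
lemma laplacian_eq_sum_fderiv [FiniteDimensional ℝ E] (W : E → ℝ)
    (c : OrthonormalBasis (Fin 3) ℝ E) (y : E) :
    Laplacian.laplacian W y = fderiv ℝ (fderiv ℝ W) y (c 0) (c 0) +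
      fderiv ℝ (fderiv ℝ W) y (c 1) (c 1) + fderiv ℝ (fderiv ℝ W) y (c 2) (c 2) := by
  rw [InnerProductSpace.laplacian_eq_iteratedFDeriv_orthonormalBasis W c]
  simp [Fin.sum_univ_three, iteratedFDeriv_two_apply]

lemma continuous_sphereMeridian (b : OrthonormalBasis (Fin 3) ℝ E) :
    Continuous (Function.uncurry (sphereMeridian b)) := by
  unfold sphereMeridian Function.uncurry
  fun_prop

lemma continuous_sphereParallel (b : OrthonormalBasis (Fin 3) ℝ E) :
    Continuous (sphereParallel b) := by
  unfold sphereParallel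
  fun_prop

lemma hasDerivAt_spherePoint_left (b : OrthonormalBasis (Fin 3) ℝ E) (r θ : ℝ) :
    HasDerivAt (fun r => spherePoint b r θ) (sphereMeridian b r θ) r :=
  ((hasDerivAt_cos r).smul_const _).add ((hasDerivAt_sin r).smul_const _)

lemma hasDerivAt_sphereMeridian (b : OrthonormalBasis (Fin 3) ℝ E) (r θ : ℝ) :
    HasDerivAt (fun r => sphereMeridian b r θ) (-spherePoint b r θ) r := by
  refine (((hasDerivAt_sin r).fun_neg.smul_const (b 2)).add
    ((hasDerivAt_cos r).smul_const (cos θ • b 0 + sin θ • b 1))).congr_deriv ?_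
  simp only [spherePoint]
  module

lemma hasDerivAt_spherePoint_right (b : OrthonormalBasis (Fin 3) ℝ E) (r θ : ℝ) :
    HasDerivAt (fun θ => spherePoint b r θ) (sin r • sphereParallel b θ) θ :=
  ((((hasDerivAt_cos θ).smul_const _).add ((hasDerivAt_sin θ).smul_const _)).const_smul
    (sin r)).const_add _

lemma hasDerivAt_sphereParallel (b : OrthonormalBasis (Fin 3) ℝ E) (r θ : ℝ) :
    HasDerivAt (sphereParallel b)
      (-(sin r • spherePoint b r θ + cos r • sphereMeridian b r θ)) θ := by
  refine (((hasDerivAt_sin θ).fun_neg.smul_const (b 0)).add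
    ((hasDerivAt_cos θ).smul_const (b 1))).congr_deriv ?_
  have h : cos θ • b 0 + sin θ • b 1 =
      (sin r ^ 2 + cos r ^ 2) • (cos θ • b 0 + sin θ • b 1) := by
    rw [sin_sq_add_cos_sq, one_smul]
  have h' : -cos θ • b 0 + -sin θ • b 1 = -(cos θ • b 0 + sin θ • b 1) := by module
  rw [h', h]
  simp only [spherePoint, sphereMeridian]
  module

lemma DifferentiableAt.hasDerivAt_comp_curve {F : Type*} [NormedAddCommGroup F] [NormedSpace ℝ F]
    {W : E → F} {γ : ℝ → E} {γ' : E} {t : ℝ} (hW : DifferentiableAt ℝ W (γ t))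
    (hγ : HasDerivAt γ γ' t) : HasDerivAt (fun t => W (γ t)) (fderiv ℝ W (γ t) γ') t :=
  hW.hasFDerivAt.comp_hasDerivAt t hγ

lemma exists_circleIntegral_ode [FiniteDimensional ℝ E] {W : E → ℝ}
    (hW : ContDiffOn ℝ 2 W {y | y ≠ 0})
    (hom : ∀ t : ℝ, 0 < t → ∀ y, W (t • y) = W y) (b : OrthonormalBasis (Fin 3) ℝ E) :
    ∃ M₁ M₂ : ℝ → ℝ,
      (∀ r, HasDerivAt (fun r => ∫ θ in 0..2 * π, W (spherePoint b r θ)) (M₁ r) r) ∧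
      (∀ r, HasDerivAt M₁ (M₂ r) r) ∧ M₁ 0 = 0 ∧
      ∀ r, sin r ≠ 0 → sin r * M₂ r + cos r * M₁ r =
        sin r * ∫ θ in 0..2 * π, Laplacian.laplacian W (spherePoint b r θ) := by
  have hopen : IsOpen {y : E | y ≠ 0} := isOpen_ne
  have hD : ∀ y, y ≠ 0 → DifferentiableAt ℝ W y := fun y hy =>
    (hW.contDiffAt (hopen.mem_nhds hy)).differentiableAt (by norm_num)
  have hW1 : ContDiffOn ℝ 1 (fderiv ℝ W) {y | y ≠ 0} :=
    hW.fderiv_of_isOpen hopen (by norm_num)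
  have hD2 : ∀ y, y ≠ 0 → DifferentiableAt ℝ (fderiv ℝ W) y := fun y hy =>
    (hW1.contDiffAt (hopen.mem_nhds hy)).differentiableAt (by norm_num)
  have hW2 : ContinuousOn (fderiv ℝ (fderiv ℝ W)) {y | y ≠ 0} :=
    (hW1.fderiv_of_isOpen (m := 0) hopen (by norm_num)).continuousOn
  have hp := continuous_spherePoint b
  have hp0 : ∀ p, Function.uncurry (spherePoint b) p ∈ {y : E | y ≠ 0} :=
    fun p => spherePoint_ne_zero b _ _
  have cW : Continuous (Function.uncurry fun r θ => W (spherePoint b r θ)) :=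
    hW.continuousOn.comp_continuous hp hp0
  have cD := hW1.continuousOn.comp_continuous hp hp0
  have cD2 := hW2.comp_continuous hp hp0
  have dWr : ∀ r θ, HasDerivAt (fun r => W (spherePoint b r θ))
      (fderiv ℝ W (spherePoint b r θ) (sphereMeridian b r θ)) r := fun r θ =>
    (hD _ (spherePoint_ne_zero b r θ)).hasDerivAt_comp_curve
      (γ := fun r => spherePoint b r θ) (hasDerivAt_spherePoint_left b r θ)
  have euler : ∀ r θ, fderiv ℝ W (spherePoint b r θ) (spherePoint b r θ) = 0 := fun r θ =>
    fderiv_apply_self_of_homogeneous hom (hD _ (spherePoint_ne_zero b r θ))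
  have dWrr : ∀ r θ, HasDerivAt (fun r => fderiv ℝ W (spherePoint b r θ) (sphereMeridian b r θ))
      (fderiv ℝ (fderiv ℝ W) (spherePoint b r θ) (sphereMeridian b r θ) (sphereMeridian b r θ))
      r := fun r θ => by
    have := ((hD2 _ (spherePoint_ne_zero b r θ)).hasDerivAt_comp_curve
      (γ := fun r => spherePoint b r θ) (hasDerivAt_spherePoint_left b r θ)).clm_apply
      (hasDerivAt_sphereMeridian b r θ)
    simpa only [map_neg, euler, neg_zero, add_zero] using this
  have dWθ : ∀ r θ, HasDerivAt (fun θ => fderiv ℝ W (spherePoint b r θ) (sphereParallel b θ))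
      (sin r * fderiv ℝ (fderiv ℝ W) (spherePoint b r θ) (sphereParallel b θ) (sphereParallel b θ) -
        cos r * fderiv ℝ W (spherePoint b r θ) (sphereMeridian b r θ)) θ := fun r θ => by
    have h := ((hD2 _ (spherePoint_ne_zero b r θ)).hasDerivAt_comp_curve
      (hasDerivAt_spherePoint_right b r θ)).clm_apply (hasDerivAt_sphereParallel b r θ)
    refine h.congr_deriv ?_
    simp only [map_neg, map_add, map_smul, euler, smul_eq_mul, smul_apply]
    ring
  have cτ := continuous_sphereMeridian b
  have cν' := continuous_sphereParallel b
  have cG1 : Continuous (Function.uncurry fun r θ =>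
      fderiv ℝ W (spherePoint b r θ) (sphereMeridian b r θ)) :=
    cD.clm_apply cτ
  have cG2 : Continuous (Function.uncurry fun r θ =>
      fderiv ℝ (fderiv ℝ W) (spherePoint b r θ) (sphereMeridian b r θ) (sphereMeridian b r θ)) :=
    (cD2.clm_apply cτ).clm_apply cτ
  have cG3 : Continuous (Function.uncurry fun r θ =>
      fderiv ℝ (fderiv ℝ W) (spherePoint b r θ) (sphereParallel b θ) (sphereParallel b θ)) :=
    (cD2.clm_apply (cν'.comp continuous_snd)).clm_apply (cν'.comp continuous_snd)
  refine ⟨_, _, hasDerivAt_intervalIntegral_param cW cG1 dWr 0 (2 * π),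
    hasDerivAt_intervalIntegral_param cG1 cG2 dWrr 0 (2 * π), ?_, ?_⟩
  · have h0 : ∀ θ, spherePoint b 0 θ = b 2 := fun θ => by simp [spherePoint]
    simp only [h0, sphereMeridian]
    simp [intervalIntegral.integral_add]
  · intro r hr
    have slice : ∀ {g : ℝ → ℝ → ℝ}, Continuous (Function.uncurry g) → Continuous (g r) :=
      fun hg => hg.comp (by fun_prop : Continuous fun θ => (r, θ))
    have hΔ : ∀ θ, Laplacian.laplacian W (spherePoint b r θ) =
        fderiv ℝ (fderiv ℝ W) (spherePoint b r θ) (sphereMeridian b r θ) (sphereMeridian b r θ) +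
        fderiv ℝ (fderiv ℝ W) (spherePoint b r θ) (sphereParallel b θ) (sphereParallel b θ) :=
    fun θ => by
      obtain ⟨c, h0, h1, h2⟩ := exists_sphericalFrame b r θ
      rw [laplacian_eq_sum_fderiv W c, h1, h2, h0, fderiv_fderiv_apply_self_of_homogeneous hom hD
        (spherePoint_ne_zero b r θ) (hD2 _ (spherePoint_ne_zero b r θ)), zero_add]
    have hzero := intervalIntegral.integral_eq_sub_of_hasDerivAt (a := 0) (b := 2 * π)
      (fun θ _ => dWθ r θ) (((slice cG3).const_mul _).sub
        ((slice cG1).const_mul _) |>.intervalIntegrable _ _)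
    have hper : fderiv ℝ W (spherePoint b r (2 * π)) (sphereParallel b (2 * π)) =
        fderiv ℝ W (spherePoint b r 0) (sphereParallel b 0) := by simp [spherePoint, sphereParallel]
    rw [hper, sub_self, intervalIntegral.integral_sub
      (((slice cG3).const_mul _).intervalIntegrable _ _)
      (((slice cG1).const_mul _).intervalIntegrable _ _),
      intervalIntegral.integral_const_mul, intervalIntegral.integral_const_mul] at hzero
    simp only [hΔ]
    rw [intervalIntegral.integral_add ((slice cG2).intervalIntegrable _ _)
      ((slice cG3).intervalIntegrable _ _)]
    linarith
end

/-- The Legendre polynomial of degree two. -/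
noncomputable def legendreTwo (t : ℝ) : ℝ := (3 * t ^ 2 - 1) / 2

lemma abs_legendreTwo_le {t : ℝ} (ht : |t| ≤ 1) : |legendreTwo t| ≤ 1 := by
  have h : t ^ 2 ≤ 1 := (sq_le_one_iff_abs_le_one t).2 ht
  rw [legendreTwo, abs_le]
  constructor <;> nlinarith [sq_nonneg t]

lemma hasDerivAt_legendreTwo_cos (r : ℝ) :
    HasDerivAt (fun r => legendreTwo (cos r)) (-3 * (cos r * sin r)) r := by
  refine (((((hasDerivAt_cos r).fun_pow 2).const_mul 3).sub_const 1).div_const 2).congr_deriv ?_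
  push_cast
  ring

lemma hasDerivAt_cos_mul_sin (r : ℝ) :
    HasDerivAt (fun r => -3 * (cos r * sin r)) (-3 * (cos r ^ 2 - sin r ^ 2)) r := by
  refine (((hasDerivAt_cos r).mul (hasDerivAt_sin r)).const_mul (-3)).congr_deriv ?_
  ring

lemma abs_sub_legendreTwo_le_of_ode {M M₁ M₂ F : ℝ → ℝ} {δ : ℝ}
    (h₁ : ∀ r, HasDerivAt M (M₁ r) r) (h₂ : ∀ r, HasDerivAt M₁ (M₂ r) r) (h₀ : M₁ 0 = 0)
    (hode : ∀ r, sin r ≠ 0 → sin r * M₂ r + cos r * M₁ r + 6 * (sin r * M r) = sin r * F r)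
    (hF : ∀ r, |F r| ≤ δ) {r : ℝ} (hr : r ∈ Set.Icc 0 (π / 2)) :
    |M r - M 0 * legendreTwo (cos r)| ≤ 2 * δ := by
  set N : ℝ → ℝ := fun r => M r - M 0 * legendreTwo (cos r) with hN
  set N₁ : ℝ → ℝ := fun r => M₁ r - M 0 * (-3 * (cos r * sin r)) with hN₁
  set N₂ : ℝ → ℝ := fun r => M₂ r - M 0 * (-3 * (cos r ^ 2 - sin r ^ 2)) with hN₂
  have dN : ∀ r, HasDerivAt N (N₁ r) r := fun r =>
    (h₁ r).sub ((hasDerivAt_legendreTwo_cos r).const_mul _)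
  have dN₁ : ∀ r, HasDerivAt N₁ (N₂ r) r := fun r =>
    (h₂ r).sub ((hasDerivAt_cos_mul_sin r).const_mul _)
  set H : ℝ → ℝ := fun r => (N₁ r ^ 2 + 6 * N r ^ 2 + δ ^ 2) * exp (-r) with hH
  have dH : ∀ r, HasDerivAt H
      ((2 * N₁ r * (N₂ r + 6 * N r) - (N₁ r ^ 2 + 6 * N r ^ 2 + δ ^ 2)) * exp (-r)) r := fun r => by
    refine (((((dN₁ r).fun_pow 2).fun_add (((dN r).fun_pow 2).const_mul 6)).add_const
      (δ ^ 2)).mul (hasDerivAt_neg r).exp).congr_deriv ?_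
    push_cast
    ring
  have hanti : AntitoneOn H (Set.Icc 0 (π / 2)) := by
    refine antitoneOn_of_deriv_nonpos (convex_Icc _ _)
      (fun r _ => (dH r).continuousAt.continuousWithinAt)
      (fun r _ => (dH r).differentiableAt.differentiableWithinAt) fun r hr => ?_
    rw [interior_Icc] at hr
    rw [(dH r).deriv]
    have hs : 0 < sin r := sin_pos_of_pos_of_lt_pi hr.1 (by linarith [hr.2, pi_pos])
    have hc : 0 < cos r := cos_pos_of_mem_Ioo ⟨by linarith [hr.1, pi_pos], hr.2⟩
    have hNode : sin r * (N₂ r + 6 * N r) = sin r * F r - cos r * N₁ r := by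
      have := hode r hs.ne'
      have hsc := sin_sq_add_cos_sq r
      simp only [hN, hN₁, hN₂, legendreTwo]
      linear_combination this - 3 * M 0 * sin r * hsc
    have key : N₁ r * (N₂ r + 6 * N r) ≤ N₁ r * F r := by
      have : sin r * (N₁ r * (N₂ r + 6 * N r)) ≤ sin r * (N₁ r * F r) := by
        have h : sin r * (N₁ r * (N₂ r + 6 * N r)) = sin r * (N₁ r * F r) - cos r * N₁ r ^ 2 := by
          linear_combination N₁ r * hNode
        rw [h]
        nlinarith [mul_nonneg hc.le (sq_nonneg (N₁ r))]
      exact le_of_mul_le_mul_left this hs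
    have hF2 : F r ^ 2 ≤ δ ^ 2 := sq_le_sq' (by linarith [neg_abs_le (F r), hF r])
      ((le_abs_self _).trans (hF r))
    refine mul_nonpos_of_nonpos_of_nonneg ?_ (exp_pos _).le
    nlinarith [sq_nonneg (N₁ r - F r), sq_nonneg (N r)]
  have hle := hanti ⟨le_rfl, by positivity⟩ hr hr.1
  have hH0 : H 0 = δ ^ 2 := by simp [hH, hN, hN₁, h₀, legendreTwo]; norm_num
  have hexp : exp r ≤ 9 := by
    have h1 : exp r ≤ exp (1 + 1) := exp_le_exp.2 (by linarith [hr.2, pi_le_four])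
    have h2 : exp 1 ≤ 3 := by linarith [exp_one_lt_d9]
    rw [exp_add] at h1
    nlinarith [exp_pos 1]
  have hb : N₁ r ^ 2 + 6 * N r ^ 2 + δ ^ 2 ≤ δ ^ 2 * exp r := by
    have : (N₁ r ^ 2 + 6 * N r ^ 2 + δ ^ 2) * exp (-r) * exp r ≤ δ ^ 2 * exp r :=
      mul_le_mul_of_nonneg_right (hle.trans_eq hH0) (exp_pos r).le
    rwa [mul_assoc, ← exp_add, neg_add_cancel, exp_zero, mul_one] at this
  have hδ : 0 ≤ δ := (abs_nonneg _).trans (hF 0)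
  refine abs_le_of_sq_le_sq ?_ (by positivity)
  nlinarith [sq_nonneg (N₁ r), mul_le_mul_of_nonneg_left hexp (sq_nonneg δ)]

lemma integral_legendreTwo_mul_eq_zero_of_ode {M M₁ M₂ F : ℝ → ℝ}
    (h₁ : ∀ r, HasDerivAt M (M₁ r) r) (h₂ : ∀ r, HasDerivAt M₁ (M₂ r) r)
    (hode : ∀ r, sin r ≠ 0 → sin r * M₂ r + cos r * M₁ r + 6 * (sin r * M r) = sin r * F r)
    (hF : Continuous F) : ∫ r in 0..π, sin r * legendreTwo (cos r) * F r = 0 := by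
  have hd : ∀ r, HasDerivAt
      (fun r => sin r * (M₁ r * legendreTwo (cos r) - M r * (-3 * (cos r * sin r))))
      (cos r * (M₁ r * legendreTwo (cos r) - M r * (-3 * (cos r * sin r))) +
        sin r * (M₂ r * legendreTwo (cos r) - M r * (-3 * (cos r ^ 2 - sin r ^ 2)))) r :=
    fun r => by
    refine ((hasDerivAt_sin r).mul (((h₂ r).fun_mul (hasDerivAt_legendreTwo_cos r)).fun_sub
      ((h₁ r).fun_mul (hasDerivAt_cos_mul_sin r)))).congr_deriv ?_
    ring
  have hc : Continuous fun r => sin r * legendreTwo (cos r) * F r := by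
    unfold legendreTwo; fun_prop
  rw [intervalIntegral.integral_eq_sub_of_hasDerivAt_of_le pi_pos.le
    (fun r _ => (hd r).continuousAt.continuousWithinAt) (fun r hr => (hd r).congr_deriv ?_)
    (hc.intervalIntegrable _ _)]
  · simp
  · have hs : 0 < sin r := sin_pos_of_pos_of_lt_pi hr.1 hr.2
    have hsc := sin_sq_add_cos_sq r
    have := hode r hs.ne'
    simp only [legendreTwo] at *
    linear_combination (3 * cos r ^ 2 - 1) / 2 * this - 3 * M r * sin r * hsc

section
variable {E : Type*} [NormedAddCommGroup E] [InnerProductSpace ℝ E]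

lemma continuous_comp_spherePoint {f : E → ℝ} (hf : ContinuousOn f {y | y ≠ 0})
    (b : OrthonormalBasis (Fin 3) ℝ E) :
    Continuous (Function.uncurry fun r θ => f (spherePoint b r θ)) :=
  hf.comp_continuous (continuous_spherePoint b) fun _ => spherePoint_ne_zero b _ _

lemma continuous_comp_spherePoint_right {f : E → ℝ} (hf : ContinuousOn f {y | y ≠ 0})
    (b : OrthonormalBasis (Fin 3) ℝ E) (r : ℝ) : Continuous fun θ => f (spherePoint b r θ) :=
  (continuous_comp_spherePoint hf b).comp (by fun_prop : Continuous fun θ => (r, θ))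

lemma abs_circleIntegral_le {f : E → ℝ} {δ : ℝ} (hδ : ∀ y, ‖y‖ = 1 → |f y| ≤ δ)
    (b : OrthonormalBasis (Fin 3) ℝ E) (r : ℝ) :
    |∫ θ in 0..2 * π, f (spherePoint b r θ)| ≤ 2 * π * δ := by
  have := intervalIntegral.norm_integral_le_of_norm_le_const (a := 0) (b := 2 * π)
    (f := fun θ => f (spherePoint b r θ)) (C := δ) fun θ _ => hδ _ (norm_spherePoint b r θ)
  rw [sub_zero, abs_of_pos two_pi_pos, norm_eq_abs] at this
  linarith

variable [FiniteDimensional ℝ E]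

lemma exists_circleIntegral_legendre_ode {W f : E → ℝ} (hW : ContDiffOn ℝ 2 W {y | y ≠ 0})
    (hom : ∀ t : ℝ, 0 < t → ∀ y, W (t • y) = W y) (hf : ContinuousOn f {y | y ≠ 0})
    (pde : ∀ y, ‖y‖ = 1 → Laplacian.laplacian W y + 6 * W y = f y)
    (b : OrthonormalBasis (Fin 3) ℝ E) :
    ∃ M₁ M₂ : ℝ → ℝ,
      (∀ r, HasDerivAt (fun r => ∫ θ in 0..2 * π, W (spherePoint b r θ)) (M₁ r) r) ∧
      (∀ r, HasDerivAt M₁ (M₂ r) r) ∧ M₁ 0 = 0 ∧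
      ∀ r, sin r ≠ 0 → sin r * M₂ r + cos r * M₁ r +
        6 * (sin r * ∫ θ in 0..2 * π, W (spherePoint b r θ)) =
        sin r * ∫ θ in 0..2 * π, f (spherePoint b r θ) := by
  obtain ⟨M₁, M₂, h₁, h₂, h₀, h⟩ := exists_circleIntegral_ode hW hom b
  refine ⟨M₁, M₂, h₁, h₂, h₀, fun r hr => ?_⟩
  have hΔ : ∀ θ, Laplacian.laplacian W (spherePoint b r θ) =
      f (spherePoint b r θ) - 6 * W (spherePoint b r θ) := fun θ => by
    rw [← pde _ (norm_spherePoint b r θ)]; ring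
  rw [h r hr]
  simp only [hΔ]
  rw [intervalIntegral.integral_sub
    ((continuous_comp_spherePoint_right hf b r).intervalIntegrable _ _)
    (((continuous_comp_spherePoint_right hW.continuousOn b r).const_mul 6).intervalIntegrable _ _),
    intervalIntegral.integral_const_mul]
  ring

lemma abs_circleIntegral_sub_legendreTwo_le_half {W f : E → ℝ} {δ : ℝ}
    (hW : ContDiffOn ℝ 2 W {y | y ≠ 0})
    (hom : ∀ t : ℝ, 0 < t → ∀ y, W (t • y) = W y) (hf : ContinuousOn f {y | y ≠ 0})
    (pde : ∀ y, ‖y‖ = 1 → Laplacian.laplacian W y + 6 * W y = f y)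
    (hδ : ∀ y, ‖y‖ = 1 → |f y| ≤ δ) (b : OrthonormalBasis (Fin 3) ℝ E) {r : ℝ}
    (hr : r ∈ Set.Icc 0 (π / 2)) :
    |(∫ θ in 0..2 * π, W (spherePoint b r θ)) - 2 * π * W (b 2) * legendreTwo (cos r)| ≤
      4 * π * δ := by
  obtain ⟨M₁, M₂, h₁, h₂, h₀, h⟩ := exists_circleIntegral_legendre_ode hW hom hf pde b
  have h := abs_sub_legendreTwo_le_of_ode h₁ h₂ h₀ h (abs_circleIntegral_le hδ b) hr
  have h0 : ∫ θ in 0..2 * π, W (spherePoint b 0 θ) = 2 * π * W (b 2) := by simp [spherePoint]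
  rw [h0] at h
  linarith

/-- Circle averages of an approximate solution of `Δ W = -6 W` on the sphere are governed by the
Legendre polynomial of degree two. -/
lemma abs_circleIntegral_sub_legendreTwo_le {W f : E → ℝ} {δ : ℝ}
    (hW : ContDiffOn ℝ 2 W {y | y ≠ 0})
    (hom : ∀ t : ℝ, 0 < t → ∀ y, W (t • y) = W y) (hf : ContinuousOn f {y | y ≠ 0})
    (pde : ∀ y, ‖y‖ = 1 → Laplacian.laplacian W y + 6 * W y = f y)
    (hδ : ∀ y, ‖y‖ = 1 → |f y| ≤ δ) (b : OrthonormalBasis (Fin 3) ℝ E) {r : ℝ}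
    (hr : r ∈ Set.Icc 0 π) :
    |(∫ θ in 0..2 * π, W (spherePoint b r θ)) - 2 * π * W (b 2) * legendreTwo (cos r)| ≤
      20 * π * δ := by
  have hδ0 : 0 ≤ δ := (abs_nonneg _).trans (hδ _ (norm_spherePoint b 0 0))
  have hπδ : 0 ≤ π * δ := by positivity
  have half := fun (b : OrthonormalBasis (Fin 3) ℝ E) (r : ℝ) (hr : r ∈ Set.Icc 0 (π / 2)) =>
    abs_circleIntegral_sub_legendreTwo_le_half hW hom hf pde hδ b hr
  rcases le_total r (π / 2) with h | h
  · exact (half b r ⟨hr.1, h⟩).trans (by linarith)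
  obtain ⟨c, hc⟩ : ∃ c : OrthonormalBasis (Fin 3) ℝ E, ⇑c = ![b 0, b 1, -b 2] := by
    refine b.exists_coe_eq (orthonormal_iff_ite.2 fun i j => ?_)
    fin_cases i <;> fin_cases j <;>
      simp [-inner_self_eq_norm_sq_to_K, orthonormalBasis_inner]
  have hc0 : c 0 = b 0 := by rw [hc]; rfl
  have hc1 : c 1 = b 1 := by rw [hc]; rfl
  have hc2 : c 2 = -b 2 := by rw [hc]; rfl
  have hpt : ∀ r θ, spherePoint c r θ = spherePoint b (π - r) θ := fun r θ => by
    simp [spherePoint, hc0, hc1, hc2]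
  have e1 := half b (π / 2) ⟨by positivity, le_rfl⟩
  have e2 := half c (π / 2) ⟨by positivity, le_rfl⟩
  have e3 := half c (π - r) ⟨by linarith [hr.2], by linarith⟩
  simp only [hpt] at e2 e3
  rw [show π - π / 2 = π / 2 by ring] at e2
  rw [sub_sub_cancel, cos_pi_sub, show legendreTwo (-cos r) = legendreTwo (cos r) by
    simp [legendreTwo]] at e3
  rw [cos_pi_div_two, show legendreTwo 0 = -1 / 2 by norm_num [legendreTwo]] at e1 e2
  have e4 : |2 * π * W (b 2) - 2 * π * W (c 2)| ≤ 16 * π * δ := by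
    rw [abs_le] at e1 e2 ⊢
    constructor <;> linarith [e1.1, e1.2, e2.1, e2.2]
  have e5 : |(2 * π * W (b 2) - 2 * π * W (c 2)) * legendreTwo (cos r)| ≤ 16 * π * δ := by
    rw [abs_mul]
    exact (mul_le_of_le_one_right (abs_nonneg _) (abs_legendreTwo_le (abs_cos_le_one r))).trans e4
  rw [abs_le] at e3 e5 ⊢
  constructor <;> linarith [e3.1, e3.2, e5.1, e5.2]

lemma integral_legendreTwo_mul_circleIntegral {W f : E → ℝ}
    (hW : ContDiffOn ℝ 2 W {y | y ≠ 0})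
    (hom : ∀ t : ℝ, 0 < t → ∀ y, W (t • y) = W y) (hf : ContinuousOn f {y | y ≠ 0})
    (pde : ∀ y, ‖y‖ = 1 → Laplacian.laplacian W y + 6 * W y = f y)
    (b : OrthonormalBasis (Fin 3) ℝ E) :
    ∫ r in 0..π, sin r * legendreTwo (cos r) * ∫ θ in 0..2 * π, f (spherePoint b r θ) = 0 := by
  obtain ⟨M₁, M₂, h₁, h₂, h₀, h⟩ := exists_circleIntegral_legendre_ode hW hom hf pde b
  exact integral_legendreTwo_mul_eq_zero_of_ode h₁ h₂ h
    (intervalIntegral.continuous_parametric_intervalIntegral_of_continuous'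
      (continuous_comp_spherePoint hf b) 0 (2 * π))
end

section
variable {E : Type*} [NormedAddCommGroup E] [InnerProductSpace ℝ E]

/-- Rotation by the angle `θ` about the axis `b 2`. -/
noncomputable def axisRotation (b : OrthonormalBasis (Fin 3) ℝ E) (θ : ℝ) (y : E) : E :=
  inner ℝ (b 0) y • (cos θ • b 0 + sin θ • b 1) + inner ℝ (b 1) y • (-sin θ • b 0 + cos θ • b 1) +
    inner ℝ (b 2) y • b 2

lemma continuous_axisRotation (b : OrthonormalBasis (Fin 3) ℝ E) :
    Continuous (Function.uncurry (axisRotation b)) := by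
  unfold axisRotation Function.uncurry
  fun_prop

lemma exists_linearIsometryEquiv_eq_axisRotation (b : OrthonormalBasis (Fin 3) ℝ E) (θ : ℝ) :
    ∃ R : E ≃ₗᵢ[ℝ] E, ⇑R = axisRotation b θ := by
  obtain ⟨c, hc⟩ : ∃ c : OrthonormalBasis (Fin 3) ℝ E,
      ⇑c = ![cos θ • b 0 + sin θ • b 1, -sin θ • b 0 + cos θ • b 1, b 2] := by
    refine b.exists_coe_eq (orthonormal_iff_ite.2 fun i j => ?_)
    have hθ := sin_sq_add_cos_sq θ
    fin_cases i <;> fin_cases j <;>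
      simp [-inner_self_eq_norm_sq_to_K, inner_add_left, inner_add_right, real_inner_smul_left,
        real_inner_smul_right, orthonormalBasis_inner] <;> grind
  refine ⟨b.equiv c (Equiv.refl _), funext fun y => ?_⟩
  rw [OrthonormalBasis.equiv_apply, Fin.sum_univ_three]
  simp [hc, axisRotation, OrthonormalBasis.repr_apply_apply]

lemma inner_axisRotation (b : OrthonormalBasis (Fin 3) ℝ E) (θ : ℝ) (y : E) :
    inner ℝ (b 2) (axisRotation b θ y) = inner ℝ (b 2) y := by
  simp [-inner_self_eq_norm_sq_to_K, axisRotation, inner_add_right,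
    real_inner_smul_right, orthonormalBasis_inner]

lemma norm_axisRotation (b : OrthonormalBasis (Fin 3) ℝ E) (θ : ℝ) (y : E) :
    ‖axisRotation b θ y‖ = ‖y‖ := by
  obtain ⟨R, hR⟩ := exists_linearIsometryEquiv_eq_axisRotation b θ
  rw [← hR, R.norm_map]

lemma exists_axisRotation_eq_spherePoint (b : OrthonormalBasis (Fin 3) ℝ E) {y : E} (hy : y ≠ 0) :
    ∃ r ∈ Set.Icc 0 π, ∃ α : ℝ, cos r = inner ℝ (b 2) y / ‖y‖ ∧
      ∀ θ, axisRotation b θ y = ‖y‖ • spherePoint b r (θ + α) := by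
  have hy0 : 0 < ‖y‖ := norm_pos_iff.2 hy
  set z : ℂ := ⟨inner ℝ (b 0) y, inner ℝ (b 1) y⟩ with hz
  set t : ℝ := inner ℝ (b 2) y / ‖y‖ with ht
  have hsum := b.sum_sq_norm_inner_right y
  rw [Fin.sum_univ_three] at hsum
  simp only [norm_eq_abs, sq_abs] at hsum
  have hzn : ‖z‖ ^ 2 = ‖y‖ ^ 2 * (1 - t ^ 2) := by
    rw [Complex.sq_norm, Complex.normSq_mk, ht]
    field_simp
    linarith
  have ht1 : t ^ 2 ≤ 1 := by
    have : 0 ≤ ‖y‖ ^ 2 * (1 - t ^ 2) := hzn ▸ sq_nonneg _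
    have := nonneg_of_mul_nonneg_right this (by positivity)
    linarith
  have hzn' : ‖z‖ = ‖y‖ * sin (arccos t) := by
    rw [sin_arccos, ← sqrt_sq (norm_nonneg z), hzn, sqrt_mul (by positivity), sqrt_sq hy0.le]
  have hcos : cos (arccos t) = t :=
    cos_arccos (abs_le.1 ((sq_le_one_iff_abs_le_one t).1 ht1)).1
      (abs_le.1 ((sq_le_one_iff_abs_le_one t).1 ht1)).2
  refine ⟨arccos t, ⟨arccos_nonneg t, arccos_le_pi t⟩, z.arg, hcos, fun θ => ?_⟩
  have h0 : inner ℝ (b 0) y = ‖y‖ * sin (arccos t) * cos z.arg := by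
    rw [← hzn', Complex.norm_mul_cos_arg]
  have h1 : inner ℝ (b 1) y = ‖y‖ * sin (arccos t) * sin z.arg := by
    rw [← hzn', Complex.norm_mul_sin_arg]
  have h2 : inner ℝ (b 2) y = ‖y‖ * cos (arccos t) := by
    rw [hcos, ht]; field_simp
  rw [axisRotation, spherePoint, h0, h1, h2, cos_add, sin_add]
  module

lemma abs_integral_axisRotation_sub_le [FiniteDimensional ℝ E] {W f : E → ℝ} {δ : ℝ}
    (hW : ContDiffOn ℝ 2 W {y | y ≠ 0})
    (hom : ∀ t : ℝ, 0 < t → ∀ y, W (t • y) = W y) (hf : ContinuousOn f {y | y ≠ 0})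
    (pde : ∀ y, ‖y‖ = 1 → Laplacian.laplacian W y + 6 * W y = f y)
    (hδ : ∀ y, ‖y‖ = 1 → |f y| ≤ δ) (b : OrthonormalBasis (Fin 3) ℝ E) {y : E} (hy : y ≠ 0) :
    |(∫ θ in 0..2 * π, W (axisRotation b θ y)) -
      2 * π * W (b 2) * legendreTwo (inner ℝ (b 2) y / ‖y‖)| ≤ 20 * π * δ := by
  obtain ⟨r, hr, α, hcos, hrot⟩ := exists_axisRotation_eq_spherePoint b hy
  have hper : Function.Periodic (fun θ => W (spherePoint b r θ)) (2 * π) := fun θ => by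
    simp [spherePoint]
  have h : ∫ θ in 0..2 * π, W (axisRotation b θ y) = ∫ θ in 0..2 * π, W (spherePoint b r θ) := by
    simp only [hrot, hom _ (norm_pos_iff.2 hy)]
    rw [intervalIntegral.integral_comp_add_right (fun θ => W (spherePoint b r θ)) α,
      zero_add, add_comm, hper.intervalIntegral_add_eq α 0, zero_add]
  rw [h, ← hcos]
  exact abs_circleIntegral_sub_legendreTwo_le hW hom hf pde hδ b hr
end

section
variable {E : Type*} [NormedAddCommGroup E] [InnerProductSpace ℝ E]

/-- The zonal harmonic of degree two with pole `x`, extended homogeneously. -/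
noncomputable def zonalTwo (x y : E) : ℝ := legendreTwo (inner ℝ x y / ‖y‖)

lemma abs_zonalTwo_le {x : E} (hx : ‖x‖ = 1) (y : E) : |zonalTwo x y| ≤ 1 := by
  refine abs_legendreTwo_le ?_
  rw [abs_div, abs_norm]
  refine div_le_one_of_le₀ ?_ (norm_nonneg y)
  simpa [hx] using abs_real_inner_le_norm x y

lemma zonalTwo_linearIsometryEquiv (R : E ≃ₗᵢ[ℝ] E) (x y : E) :
    zonalTwo (R x) (R y) = zonalTwo x y := by
  simp [zonalTwo]

lemma zonalTwo_axisRotation (b : OrthonormalBasis (Fin 3) ℝ E) (θ : ℝ) (y : E) :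
    zonalTwo (b 2) (axisRotation b θ y) = zonalTwo (b 2) y := by
  rw [zonalTwo, zonalTwo, inner_axisRotation, norm_axisRotation]

variable [FiniteDimensional ℝ E] [MeasurableSpace E] [BorelSpace E]

lemma measurable_zonalTwo (x : E) : Measurable (zonalTwo x) := by
  unfold zonalTwo legendreTwo
  fun_prop

lemma setIntegral_ball_comp_linearIsometryEquiv (R : E ≃ₗᵢ[ℝ] E) (g : E → ℝ) :
    ∫ y in Metric.ball (0 : E) 1, g (R y) = ∫ y in Metric.ball (0 : E) 1, g y := by
  have h := R.measurePreserving.restrict_preimage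
    (Metric.isOpen_ball (x := 0) (ε := 1)).measurableSet
  rw [R.preimage_ball, map_zero] at h
  exact h.integral_comp R.toHomeomorph.measurableEmbedding g

instance isFiniteMeasure_restrict_unitBall :
    IsFiniteMeasure (volume.restrict (Metric.ball (0 : E) 1)) :=
  ⟨by simpa using Metric.isBounded_ball.measure_lt_top⟩

lemma integrableOn_ball_of_bounded {g : E → ℝ} (hg : Measurable g) {C : ℝ}
    (hC : ∀ y, |g y| ≤ C) : IntegrableOn g (Metric.ball (0 : E) 1) :=
  Integrable.of_bound hg.aestronglyMeasurable C (Filter.Eventually.of_forall hC)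

lemma integrableOn_zonalTwo_mul {W : E → ℝ} (hW : Measurable W) {C : ℝ}
    (hC : ∀ y, |W y| ≤ C) {x : E} (hx : ‖x‖ = 1) :
    IntegrableOn (fun y => zonalTwo x y * W y) (Metric.ball (0 : E) 1) := by
  refine integrableOn_ball_of_bounded ((measurable_zonalTwo x).mul hW) (C := C) fun y => ?_
  rw [abs_mul]
  exact (mul_le_of_le_one_left (abs_nonneg _) (abs_zonalTwo_le hx y)).trans (hC y)

lemma integrableOn_zonalTwo_sq {x : E} (hx : ‖x‖ = 1) :
    IntegrableOn (fun y => zonalTwo x y ^ 2) (Metric.ball (0 : E) 1) := by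
  simpa only [sq] using integrableOn_zonalTwo_mul (measurable_zonalTwo x) (abs_zonalTwo_le hx) hx

/-- The squared norm of the zonal harmonics of degree two over the unit ball does not depend on
the pole. -/
lemma setIntegral_zonalTwo_sq_eq (b c : OrthonormalBasis (Fin 3) ℝ E) :
    ∫ y in Metric.ball (0 : E) 1, zonalTwo (b 2) y ^ 2 =
      ∫ y in Metric.ball (0 : E) 1, zonalTwo (c 2) y ^ 2 := by
  rw [← setIntegral_ball_comp_linearIsometryEquiv (b.equiv c (Equiv.refl _))
    fun y => zonalTwo (c 2) y ^ 2]
  have h : c 2 = b.equiv c (Equiv.refl _) (b 2) := by simp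
  simp_rw [h, zonalTwo_linearIsometryEquiv]

lemma setIntegral_zonalTwo_sq_pos {x : E} (hx : ‖x‖ = 1) :
    0 < ∫ y in Metric.ball (0 : E) 1, zonalTwo x y ^ 2 := by
  have hint := integrableOn_zonalTwo_sq hx
  rw [setIntegral_pos_iff_support_of_nonneg_ae
    (Filter.Eventually.of_forall fun y => sq_nonneg _) hint]
  have hopen : IsOpen ({y : E | y ≠ 0} ∩ {y : E | 3 * inner ℝ x y ^ 2 ≠ ‖y‖ ^ 2} ∩
      Metric.ball (0 : E) 1) :=
    (isOpen_ne.inter (isOpen_ne_fun (by fun_prop) (by fun_prop))).inter Metric.isOpen_ball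
  refine (hopen.measure_pos volume ⟨(1 / 2 : ℝ) • x, ⟨?_, ?_⟩, ?_⟩).trans_le
    (measure_mono (Set.inter_subset_inter_left _ ?_))
  · exact smul_ne_zero (by norm_num) (norm_ne_zero_iff.1 (by simp [hx]))
  · simp only [Set.mem_ofPred_eq, inner_smul_right, real_inner_self_eq_norm_sq, norm_smul, hx]
    norm_num
  · simp [norm_smul, hx]; norm_num
  · rintro y ⟨hy, h⟩ h0
    refine h ?_
    have hn : ‖y‖ ≠ 0 := norm_ne_zero_iff.2 hy
    have h1 : zonalTwo x y = 0 := by simpa using h0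
    rw [zonalTwo, legendreTwo] at h1
    field_simp at h1
    linarith

/-- Approximate reproducing property of the zonal harmonics of degree two. -/
lemma abs_setIntegral_zonalTwo_mul_sub_le {W f : E → ℝ} {δ C : ℝ}
    (hW : ContDiffOn ℝ 2 W {y | y ≠ 0})
    (hom : ∀ t : ℝ, 0 < t → ∀ y, W (t • y) = W y) (hf : ContinuousOn f {y | y ≠ 0})
    (pde : ∀ y, ‖y‖ = 1 → Laplacian.laplacian W y + 6 * W y = f y)
    (hδ : ∀ y, ‖y‖ = 1 → |f y| ≤ δ) (hC : ∀ y, |W y| ≤ C) (b : OrthonormalBasis (Fin 3) ℝ E) :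
    |(∫ y in Metric.ball (0 : E) 1, zonalTwo (b 2) y * W y) -
      W (b 2) * ∫ y in Metric.ball (0 : E) 1, zonalTwo (b 2) y ^ 2| ≤
      10 * δ * volume.real (Metric.ball (0 : E) 1) := by
  have hWm : Measurable W := measurable_of_continuousOn_compl_singleton 0 hW.continuousOn
  have hb : ‖b 2‖ = 1 := b.orthonormal.1 2
  set μ : Measure E := volume.restrict (Metric.ball (0 : E) 1) with hμ
  have : IsFiniteMeasure μ := isFiniteMeasure_restrict_unitBall
  have : IsFiniteMeasure (volume.restrict (Set.uIoc 0 (2 * π))) :=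
    ⟨by rw [Measure.restrict_apply_univ, Set.uIoc_of_le two_pi_pos.le, volume_Ioc]
        exact ENNReal.ofReal_lt_top⟩
  set F : ℝ → E → ℝ := fun θ y => zonalTwo (b 2) y * W (axisRotation b θ y) with hF
  have hFm : Measurable (Function.uncurry F) :=
    ((measurable_zonalTwo (b 2)).comp measurable_snd).mul
      (hWm.comp (continuous_axisRotation b).measurable)
  have hFC : ∀ p, ‖Function.uncurry F p‖ ≤ C := fun p => by
    rw [norm_eq_abs, Function.uncurry, abs_mul]
    exact (mul_le_of_le_one_left (abs_nonneg _) (abs_zonalTwo_le hb _)).trans (hC _)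
  have hFint : Integrable (Function.uncurry F)
      ((volume.restrict (Set.uIoc 0 (2 * π))).prod μ) :=
    Integrable.of_bound hFm.aestronglyMeasurable C (Filter.Eventually.of_forall hFC)
  have hswap : ∫ y, (∫ θ in 0..2 * π, F θ y) ∂μ = 2 * π * ∫ y, zonalTwo (b 2) y * W y ∂μ := by
    rw [← intervalIntegral_integral_swap hFint]
    have : ∀ θ, ∫ y, F θ y ∂μ = ∫ y, zonalTwo (b 2) y * W y ∂μ := fun θ => by
      obtain ⟨R, hR⟩ := exists_linearIsometryEquiv_eq_axisRotation b θ
      rw [hμ, ← setIntegral_ball_comp_linearIsometryEquiv R fun y => zonalTwo (b 2) y * W y]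
      simp only [hR, hF, zonalTwo_axisRotation]
    simp [this]
  have hsq : Integrable (fun y => zonalTwo (b 2) y ^ 2) μ := integrableOn_zonalTwo_sq hb
  have hFint' : Integrable (fun y => ∫ θ in 0..2 * π, F θ y) μ := by
    simp_rw [intervalIntegral.integral_of_le two_pi_pos.le]
    rw [Set.uIoc_of_le two_pi_pos.le] at hFint
    exact hFint.integral_prod_right
  have hdiff : 2 * π * ((∫ y, zonalTwo (b 2) y * W y ∂μ) -
      W (b 2) * ∫ y, zonalTwo (b 2) y ^ 2 ∂μ) =
      ∫ y, ((∫ θ in 0..2 * π, F θ y) - 2 * π * W (b 2) * zonalTwo (b 2) y ^ 2) ∂μ := by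
    rw [integral_sub hFint' (hsq.const_mul _), hswap, integral_const_mul]
    ring
  have hne : ∀ᵐ y ∂μ, y ≠ 0 := by
    have : Nontrivial E := ⟨b 2, 0, by rw [← norm_ne_zero_iff, hb]; exact one_ne_zero⟩
    exact ae_restrict_of_ae (Measure.ae_ne volume 0)
  have hbound : ∀ᵐ y ∂μ, ‖(∫ θ in 0..2 * π, F θ y) - 2 * π * W (b 2) * zonalTwo (b 2) y ^ 2‖ ≤
      20 * π * δ := by
    filter_upwards [hne] with y hy
    have h := abs_integral_axisRotation_sub_le hW hom hf pde hδ b hy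
    have hrw : (∫ θ in 0..2 * π, F θ y) - 2 * π * W (b 2) * zonalTwo (b 2) y ^ 2 =
        zonalTwo (b 2) y * ((∫ θ in 0..2 * π, W (axisRotation b θ y)) -
          2 * π * W (b 2) * zonalTwo (b 2) y) := by
      rw [hF, intervalIntegral.integral_const_mul]; ring
    rw [hrw, norm_eq_abs, abs_mul]
    exact (mul_le_of_le_one_left (abs_nonneg _) (abs_zonalTwo_le hb _)).trans h
  have h := norm_integral_le_of_norm_le_const hbound
  rw [← hdiff, norm_eq_abs, abs_mul, abs_of_pos two_pi_pos, hμ,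
    measureReal_restrict_apply_univ] at h
  refine le_of_mul_le_mul_left ?_ two_pi_pos
  linarith
end

section
variable {E : Type*} [NormedAddCommGroup E] [InnerProductSpace ℝ E]

lemma sum_zonalTwo_eq_zero (b : OrthonormalBasis (Fin 3) ℝ E) {y : E} (hy : y ≠ 0) :
    ∑ i, zonalTwo (b i) y = 0 := by
  have h := b.sum_sq_norm_inner_right y
  simp only [norm_eq_abs, sq_abs] at h
  have hn : ‖y‖ ≠ 0 := norm_ne_zero_iff.2 hy
  simp only [Fin.sum_univ_three, zonalTwo, legendreTwo] at h ⊢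
  field_simp
  linarith

/-- The symmetric operator whose quadratic form is `x ↦ ‖x‖² zonalTwo x y`. -/
noncomputable def zonalTwoOperator (y : E) : E →L[ℝ] E :=
  (3 / 2 / ‖y‖ ^ 2) • (innerSL ℝ y).smulRight y - (1 / 2 : ℝ) • ContinuousLinearMap.id ℝ E

lemma inner_zonalTwoOperator (x z y : E) : inner ℝ x (zonalTwoOperator y z) =
    3 / 2 / ‖y‖ ^ 2 * (inner ℝ x y * inner ℝ z y) - 1 / 2 * inner ℝ x z := by
  simp only [zonalTwoOperator, sub_apply, smul_apply,
    ContinuousLinearMap.smulRight_apply, innerSL_apply_apply, ContinuousLinearMap.id_apply,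
    inner_sub_right, real_inner_smul_right, real_inner_comm z y]
  ring

lemma inner_zonalTwoOperator_self {x : E} (hx : ‖x‖ = 1) (y : E) :
    inner ℝ x (zonalTwoOperator y x) = zonalTwo x y := by
  rw [inner_zonalTwoOperator, real_inner_self_eq_norm_sq, hx, zonalTwo, legendreTwo]
  ring

lemma norm_zonalTwoOperator_le (y : E) : ‖zonalTwoOperator y‖ ≤ 2 := by
  have h1 : ‖(3 / 2 / ‖y‖ ^ 2) • (innerSL ℝ y).smulRight y‖ ≤ 3 / 2 := by
    rw [norm_smul, ContinuousLinearMap.norm_smulRight_apply, innerSL_apply_norm, norm_div,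
      norm_pow, norm_norm]
    rcases eq_or_ne ‖y‖ 0 with h | h
    · simp only [h]; norm_num
    · field_simp; norm_num
  have h2 : ‖(1 / 2 : ℝ) • ContinuousLinearMap.id ℝ E‖ ≤ 1 / 2 := by
    rw [norm_smul]
    have := ContinuousLinearMap.norm_id_le (𝕜 := ℝ) (E := E)
    norm_num
    linarith
  exact (norm_sub_le _ _).trans (by linarith)

variable [FiniteDimensional ℝ E] [MeasurableSpace E] [BorelSpace E]

lemma stronglyMeasurable_zonalTwoOperator :
    StronglyMeasurable (zonalTwoOperator : E → E →L[ℝ] E) := by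
  have h1 : Continuous fun y : E => (innerSL ℝ y).smulRight y := by fun_prop
  have h2 : Measurable fun y : E => 3 / 2 / ‖y‖ ^ 2 := by fun_prop
  exact (h2.stronglyMeasurable.smul h1.stronglyMeasurable).sub stronglyMeasurable_const

/-- Projections to spherical harmonics of degree two are trace free quadratic forms. -/
lemma exists_orthonormalBasis_setIntegral_zonalTwo_mul (hE : Module.finrank ℝ E = 3) {W : E → ℝ}
    (hW : Measurable W) {C : ℝ} (hC : ∀ y, |W y| ≤ C) :
    ∃ (b : OrthonormalBasis (Fin 3) ℝ E) (a : Fin 3 → ℝ), ∑ i, a i = 0 ∧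
      ∀ x, ‖x‖ = 1 → ∫ y in Metric.ball (0 : E) 1, zonalTwo x y * W y =
        ∑ i, a i * inner ℝ (b i) x ^ 2 := by
  set k : E → E →L[ℝ] E := fun y => W y • zonalTwoOperator y with hk
  have hkint : IntegrableOn k (Metric.ball (0 : E) 1) := by
    refine Integrable.of_bound
      (hW.stronglyMeasurable.smul stronglyMeasurable_zonalTwoOperator).aestronglyMeasurable (C * 2)
      (Filter.Eventually.of_forall fun y => ?_)
    rw [norm_smul]
    exact mul_le_mul (hC y) (norm_zonalTwoOperator_le y) (norm_nonneg _)
      ((abs_nonneg _).trans (hC y))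
  set T : E →L[ℝ] E := ∫ y in Metric.ball (0 : E) 1, k y with hT
  have hTinner : ∀ x z, inner ℝ x (T z) =
      ∫ y in Metric.ball (0 : E) 1, inner ℝ x (zonalTwoOperator y z) * W y := fun x z => by
    rw [hT, ContinuousLinearMap.integral_apply hkint,
      ← integral_inner (hkint.apply_continuousLinearMap z)]
    simp [hk, real_inner_smul_right, mul_comm]
  have hquad : ∀ x, ‖x‖ = 1 → ∫ y in Metric.ball (0 : E) 1, zonalTwo x y * W y =
      inner ℝ x (T x) := fun x hx => by
    simp only [hTinner, inner_zonalTwoOperator_self hx]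
  have hsymm : (T : E →ₗ[ℝ] E).IsSymmetric := fun x z => by
    rw [real_inner_comm]
    simp only [ContinuousLinearMap.coe_coe, hTinner, inner_zonalTwoOperator,
      real_inner_comm z x, mul_comm (inner ℝ z _) (inner ℝ x _)]
  refine ⟨hsymm.eigenvectorBasis hE, hsymm.eigenvalues hE, ?_, fun x hx => ?_⟩
  · set b := hsymm.eigenvectorBasis hE with hb
    have hval : ∀ i, hsymm.eigenvalues hE i =
        ∫ y in Metric.ball (0 : E) 1, zonalTwo (b i) y * W y := fun i => by
      rw [hquad _ (b.orthonormal.1 i)]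
      have := hsymm.apply_eigenvectorBasis hE i
      rw [ContinuousLinearMap.coe_coe] at this
      rw [hb, this, real_inner_smul_right, real_inner_self_eq_norm_sq,
        (hsymm.eigenvectorBasis hE).orthonormal.1 i]
      simp
    simp only [hval]
    rw [← integral_finsetSum _ fun i _ => integrableOn_zonalTwo_mul hW hC (b.orthonormal.1 i)]
    have hne : ∀ᵐ y ∂(volume.restrict (Metric.ball (0 : E) 1)), y ≠ 0 := by
      have : Nontrivial E := Module.nontrivial_of_finrank_pos (R := ℝ) (by omega)
      exact ae_restrict_of_ae (Measure.ae_ne volume 0)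
    refine integral_eq_zero_of_ae ?_
    filter_upwards [hne] with y hy
    rw [← Finset.sum_mul, sum_zonalTwo_eq_zero b hy, zero_mul, Pi.zero_apply]
  · rw [hquad x hx, ← (hsymm.eigenvectorBasis hE).sum_inner_mul_inner]
    refine Finset.sum_congr rfl fun i _ => ?_
    have h := hsymm (hsymm.eigenvectorBasis hE i) x
    rw [hsymm.apply_eigenvectorBasis, ContinuousLinearMap.coe_coe] at h
    rw [← h, real_inner_smul_left, real_inner_comm x]
    simp
    ring

lemma exists_orthonormalBasis_setIntegral_zonalTwo_mul_of_max (hE : Module.finrank ℝ E = 3)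
    {W : E → ℝ} (hW : Measurable W) {C : ℝ} (hC : ∀ y, |W y| ≤ C) :
    ∃ (b : OrthonormalBasis (Fin 3) ℝ E) (a : Fin 3 → ℝ), ∑ i, a i = 0 ∧ (∀ i, |a i| ≤ |a 2|) ∧
      ∀ x, ‖x‖ = 1 → ∫ y in Metric.ball (0 : E) 1, zonalTwo x y * W y =
        ∑ i, a i * inner ℝ (b i) x ^ 2 := by
  obtain ⟨b, a, ha, h⟩ := exists_orthonormalBasis_setIntegral_zonalTwo_mul hE hW hC
  obtain ⟨j, hj⟩ := Finite.exists_max fun i => |a i|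
  refine ⟨b.reindex (Equiv.swap j 2), a ∘ Equiv.swap j 2, ?_, fun i => ?_, fun x hx => ?_⟩
  · rw [← ha]
    exact Equiv.sum_comp (Equiv.swap j 2) a
  · simpa using hj _
  · rw [h x hx, ← Equiv.sum_comp (Equiv.swap j 2)]
    simp
end

section
variable {E : Type*} [NormedAddCommGroup E] [InnerProductSpace ℝ E]

lemma exists_orthonormalBasis_apply_two [FiniteDimensional ℝ E] (hE : Module.finrank ℝ E = 3)
    {x : E} (hx : ‖x‖ = 1) : ∃ b : OrthonormalBasis (Fin 3) ℝ E, b 2 = x := by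
  have hv : Orthonormal ℝ (({2} : Set (Fin 3)).domRestrict fun _ => x) :=
    ⟨fun _ => hx, fun i j hij => absurd (Subsingleton.elim i j) hij⟩
  obtain ⟨b, hb⟩ := hv.exists_orthonormalBasis_extension_of_card_eq (by simpa using hE)
  exact ⟨b, hb 2 rfl⟩

/-- Approximate solutions of `Δ W = -6 W` on the sphere are close to spherical harmonics of degree
two. -/
lemma exists_quadratic_approx (E : Type*) [NormedAddCommGroup E] [InnerProductSpace ℝ E]
    [FiniteDimensional ℝ E] (hE : Module.finrank ℝ E = 3) :
    ∃ κ : ℝ, 0 ≤ κ ∧ ∀ (W f : E → ℝ) (δ C : ℝ), ContDiffOn ℝ 2 W {y | y ≠ 0} →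
      (∀ t : ℝ, 0 < t → ∀ y, W (t • y) = W y) → ContinuousOn f {y | y ≠ 0} →
      (∀ y, ‖y‖ = 1 → Laplacian.laplacian W y + 6 * W y = f y) →
      (∀ y, ‖y‖ = 1 → |f y| ≤ δ) → (∀ y, |W y| ≤ C) →
      ∃ (b : OrthonormalBasis (Fin 3) ℝ E) (a : Fin 3 → ℝ), ∑ i, a i = 0 ∧
        (∀ i, |a i| ≤ |a 2|) ∧
        ∀ x, ‖x‖ = 1 → |W x - ∑ i, a i * inner ℝ (b i) x ^ 2| ≤ κ * δ := by
  borelize E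
  set e : OrthonormalBasis (Fin 3) ℝ E := (stdOrthonormalBasis ℝ E).reindex (finCongr hE)
  set c : ℝ := ∫ y in Metric.ball (0 : E) 1, zonalTwo (e 2) y ^ 2 with hc
  have hc0 : 0 < c := setIntegral_zonalTwo_sq_pos (e.orthonormal.1 2)
  refine ⟨10 * volume.real (Metric.ball (0 : E) 1) / c, by positivity,
    fun W f δ C hW hom hf pde hδ hC => ?_⟩
  obtain ⟨b, a, ha, hmax, h⟩ := exists_orthonormalBasis_setIntegral_zonalTwo_mul_of_max hE
    (measurable_of_continuousOn_compl_singleton 0 hW.continuousOn) hC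
  refine ⟨b, fun i => a i / c, by rw [← Finset.sum_div, ha, zero_div], fun i => ?_, fun x hx => ?_⟩
  · simpa only [abs_div] using div_le_div_of_nonneg_right (hmax i) (abs_nonneg c)
  · obtain ⟨b', rfl⟩ := exists_orthonormalBasis_apply_two hE hx
    have h1 := abs_setIntegral_zonalTwo_mul_sub_le hW hom hf pde hδ hC b'
    rw [h _ hx, setIntegral_zonalTwo_sq_eq b' e, ← hc] at h1
    have h2 : W (b' 2) - ∑ i, a i / c * inner ℝ (b i) (b' 2) ^ 2 =
        -((∑ i, a i * inner ℝ (b i) (b' 2) ^ 2 - W (b' 2) * c) / c) := by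
      rw [sub_div, mul_div_cancel_right₀ _ hc0.ne', Finset.sum_div, neg_sub]
      congr 1
      exact Finset.sum_congr rfl fun i _ => by ring
    rw [h2, abs_neg, abs_div, abs_of_pos hc0, div_mul_eq_mul_div]
    exact div_le_div_of_nonneg_right (h1.trans (by linarith)) hc0.le

lemma integral_sq_add_mul_cos_two_mul (u v : ℝ) :
    ∫ θ in 0..2 * π, (u + v * cos (2 * θ)) ^ 2 = 2 * π * (u ^ 2 + v ^ 2 / 2) := by
  have h : ∀ θ ∈ Set.uIcc 0 (2 * π), HasDerivAt
      (fun θ => (u ^ 2 + v ^ 2 / 2) * θ + u * v * sin (2 * θ) +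
        v ^ 2 / 4 * (sin (2 * θ) * cos (2 * θ))) ((u + v * cos (2 * θ)) ^ 2) θ := fun θ _ => by
    have h2 : HasDerivAt (fun θ : ℝ => 2 * θ) 2 θ := by
      simpa using (hasDerivAt_id θ).const_mul 2
    refine ((((hasDerivAt_id θ).const_mul (u ^ 2 + v ^ 2 / 2)).fun_add
      (h2.sin.const_mul (u * v))).fun_add
      ((h2.sin.fun_mul h2.cos).const_mul (v ^ 2 / 4))).congr_deriv ?_
    linear_combination (-v ^ 2 / 2) * sin_sq_add_cos_sq (2 * θ)
  rw [intervalIntegral.integral_eq_sub_of_hasDerivAt h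
    ((by fun_prop : Continuous fun θ => (u + v * cos (2 * θ)) ^ 2).intervalIntegrable _ _)]
  have : sin (2 * (2 * π)) = 0 := by
    rw [show 2 * (2 * π) = (4 : ℕ) * π by push_cast; ring, sin_nat_mul_pi]
  simp [this]
  ring

lemma integral_sin_mul_legendreTwo_mul (c β : ℝ) :
    ∫ r in 0..π, sin r * legendreTwo (cos r) *
      ((c * legendreTwo (cos r)) ^ 2 + (β * sin r ^ 2) ^ 2 / 2) =
      4 / 35 * c ^ 2 - 16 / 105 * β ^ 2 := by
  have hs : ∀ r : ℝ, sin r ^ 2 = 1 - cos r ^ 2 := sin_sq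
  simp only [hs]
  have h : ∀ r ∈ Set.uIcc 0 π, HasDerivAt (fun r =>
      -(c ^ 2 / 8 * (27 / 7 * cos r ^ 7 - 27 / 5 * cos r ^ 5 + 3 * cos r ^ 3 - cos r) +
        β ^ 2 / 4 * (3 / 7 * cos r ^ 7 - 7 / 5 * cos r ^ 5 + 5 / 3 * cos r ^ 3 - cos r)))
      (sin r * legendreTwo (cos r) *
        ((c * legendreTwo (cos r)) ^ 2 + (β * (1 - cos r ^ 2)) ^ 2 / 2)) r := fun r _ => by
    have d := hasDerivAt_cos r
    refine (((((((d.fun_pow 7).const_mul (27 / 7)).fun_sub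
      ((d.fun_pow 5).const_mul (27 / 5))).fun_add
      ((d.fun_pow 3).const_mul 3)).fun_sub d).const_mul (c ^ 2 / 8)).fun_add
      ((((((d.fun_pow 7).const_mul (3 / 7)).fun_sub ((d.fun_pow 5).const_mul (7 / 5))).fun_add
      ((d.fun_pow 3).const_mul (5 / 3))).fun_sub d).const_mul (β ^ 2 / 4))).fun_neg.congr_deriv ?_
    simp only [legendreTwo]
    push_cast
    ring
  rw [intervalIntegral.integral_eq_sub_of_hasDerivAt h (by
    apply Continuous.intervalIntegrable
    unfold legendreTwo
    fun_prop)]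
  simp
  ring

/-- The triple product of a spherical harmonic of degree two, against the zonal harmonic of one of
its axes. -/
lemma integral_legendreTwo_mul_quadratic_sq (b : OrthonormalBasis (Fin 3) ℝ E) {a : Fin 3 → ℝ}
    (ha : ∑ i, a i = 0) :
    ∫ r in 0..π, sin r * legendreTwo (cos r) * ∫ θ in 0..2 * π,
      (∑ i, a i * inner ℝ (b i) (spherePoint b r θ) ^ 2) ^ 2 =
      16 * π / 105 * (a 2 ^ 2 + 2 * a 0 * a 1) := by
  rw [Fin.sum_univ_three] at ha
  have h2 : a 2 = -(a 0 + a 1) := by linarith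
  have hpt : ∀ r θ, ∑ i, a i * inner ℝ (b i) (spherePoint b r θ) ^ 2 =
      a 2 * legendreTwo (cos r) + ((a 0 - a 1) / 2 * sin r ^ 2) * cos (2 * θ) := fun r θ => by
    simp only [Fin.sum_univ_three, spherePoint, inner_add_right, real_inner_smul_right,
      orthonormalBasis_inner]
    simp only [legendreTwo, cos_two_mul, h2]
    simp
    have hr := sin_sq r
    have hθ := sin_sq θ
    rw [mul_pow, mul_pow, hθ, hr]
    ring
  have hint : ∀ r, sin r * legendreTwo (cos r) * ∫ θ in 0..2 * π,
      (∑ i, a i * inner ℝ (b i) (spherePoint b r θ) ^ 2) ^ 2 =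
      2 * π * (sin r * legendreTwo (cos r) * ((a 2 * legendreTwo (cos r)) ^ 2 +
        ((a 0 - a 1) / 2 * sin r ^ 2) ^ 2 / 2)) := fun r => by
    simp only [hpt, integral_sq_add_mul_cos_two_mul]
    ring
  simp only [hint]
  rw [intervalIntegral.integral_const_mul, integral_sin_mul_legendreTwo_mul, h2]
  ring

lemma abs_sum_mul_inner_sq_le (b : OrthonormalBasis (Fin 3) ℝ E) {a : Fin 3 → ℝ} {A : ℝ}
    (ha : ∀ i, |a i| ≤ A) {x : E} (hx : ‖x‖ = 1) : |∑ i, a i * inner ℝ (b i) x ^ 2| ≤ A := by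
  have h := b.sum_sq_norm_inner_right x
  simp only [norm_eq_abs, sq_abs, hx] at h
  calc |∑ i, a i * inner ℝ (b i) x ^ 2| ≤ ∑ i, |a i * inner ℝ (b i) x ^ 2| :=
        Finset.abs_sum_le_sum_abs _ _
    _ ≤ ∑ i, A * inner ℝ (b i) x ^ 2 := Finset.sum_le_sum fun i _ => by
        rw [abs_mul, abs_of_nonneg (sq_nonneg (inner ℝ (b i) x))]
        exact mul_le_mul_of_nonneg_right (ha i) (sq_nonneg _)
    _ = A := by rw [← Finset.mul_sum, h]; ring

lemma mul_nonneg_of_abs_le_abs_add {p q : ℝ} (hp : |p| ≤ |p + q|) (hq : |q| ≤ |p + q|) :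
    0 ≤ p * q := by
  rw [← sq_le_sq] at hp hq
  by_contra! h
  rcases mul_neg_iff.1 h with ⟨h1, h2⟩ | ⟨h1, h2⟩ <;> nlinarith
end

section
variable {E : Type*} [NormedAddCommGroup E] [InnerProductSpace ℝ E] [FiniteDimensional ℝ E]

/-- Solvability of `Δ W + 6 W = f` bounds the quadratic part of `f`. -/
lemma sq_le_of_abs_add_three_mul_sq_le {W f : E → ℝ} {η : ℝ}
    (hW : ContDiffOn ℝ 2 W {y | y ≠ 0})
    (hom : ∀ t : ℝ, 0 < t → ∀ y, W (t • y) = W y) (hf : ContinuousOn f {y | y ≠ 0})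
    (pde : ∀ y, ‖y‖ = 1 → Laplacian.laplacian W y + 6 * W y = f y)
    (b : OrthonormalBasis (Fin 3) ℝ E) {a : Fin 3 → ℝ} (ha : ∑ i, a i = 0)
    (hmax : ∀ i, |a i| ≤ |a 2|)
    (hη : ∀ y, ‖y‖ = 1 → |f y + 3 * (∑ i, a i * inner ℝ (b i) y ^ 2) ^ 2| ≤ η) :
    a 2 ^ 2 ≤ 18 * η := by
  set φ : E → ℝ := fun y => ∑ i, a i * inner ℝ (b i) y ^ 2 with hφ
  have hφc : ContinuousOn (fun y => φ y ^ 2) {y | y ≠ 0} := by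
    simp only [hφ]
    fun_prop
  have hη0 : 0 ≤ η := (abs_nonneg _).trans (hη _ (norm_spherePoint b 0 0))
  have hcirc : ∀ r, ∫ θ in 0..2 * π, (f (spherePoint b r θ) + 3 * φ (spherePoint b r θ) ^ 2) =
      (∫ θ in 0..2 * π, f (spherePoint b r θ)) +
        3 * ∫ θ in 0..2 * π, φ (spherePoint b r θ) ^ 2 := fun r => by
    rw [intervalIntegral.integral_add
      ((continuous_comp_spherePoint_right hf b r).intervalIntegrable _ _)
      (((continuous_comp_spherePoint_right hφc b r).const_mul 3).intervalIntegrable _ _),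
      intervalIntegral.integral_const_mul]
  have hcont : ∀ {g : E → ℝ}, ContinuousOn g {y | y ≠ 0} → Continuous fun r =>
      sin r * legendreTwo (cos r) * ∫ θ in 0..2 * π, g (spherePoint b r θ) := fun {g} hg => by
    have h1 : Continuous fun r => ∫ θ in 0..2 * π, g (spherePoint b r θ) :=
      intervalIntegral.continuous_parametric_intervalIntegral_of_continuous'
        (continuous_comp_spherePoint hg b) 0 (2 * π)
    unfold legendreTwo
    fun_prop
  have htotal : ∫ r in 0..π, sin r * legendreTwo (cos r) * ∫ θ in 0..2 * π,
      (f (spherePoint b r θ) + 3 * φ (spherePoint b r θ) ^ 2) =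
      3 * (16 * π / 105 * (a 2 ^ 2 + 2 * a 0 * a 1)) := by
    have h := intervalIntegral.integral_add ((hcont hf).intervalIntegrable 0 π (μ := volume))
      (((hcont hφc).const_mul 3).intervalIntegrable 0 π)
    rw [integral_legendreTwo_mul_circleIntegral hW hom hf pde b, zero_add,
      intervalIntegral.integral_const_mul, integral_legendreTwo_mul_quadratic_sq b ha] at h
    rw [← h]
    refine intervalIntegral.integral_congr fun r _ => ?_
    simp only [hcirc]
    ring
  have hbound := intervalIntegral.norm_integral_le_of_norm_le_const (a := 0) (b := π)
    (f := fun r => sin r * legendreTwo (cos r) * ∫ θ in 0..2 * π,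
      (f (spherePoint b r θ) + 3 * φ (spherePoint b r θ) ^ 2)) (C := 2 * π * η) fun r _ => by
    rw [norm_eq_abs, abs_mul, abs_mul]
    exact (mul_le_of_le_one_left (abs_nonneg _) (mul_le_one₀ (abs_sin_le_one r) (abs_nonneg _)
      (abs_legendreTwo_le (abs_cos_le_one r)))).trans
      (abs_circleIntegral_le (f := fun y => f y + 3 * φ y ^ 2) hη b r)
  rw [htotal, norm_eq_abs, sub_zero, abs_of_pos pi_pos] at hbound
  rw [Fin.sum_univ_three] at ha
  have h2 : |a 2| = |a 0 + a 1| := by rw [← abs_neg]; congr 1; linarith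
  have hpq : 0 ≤ a 0 * a 1 := mul_nonneg_of_abs_le_abs_add (h2 ▸ hmax 0) (h2 ▸ hmax 1)
  have h3 : π * (48 / 105 * (a 2 ^ 2 + 2 * a 0 * a 1)) ≤ π * (2 * π * η) := by
    linarith [le_abs_self (3 * (16 * π / 105 * (a 2 ^ 2 + 2 * a 0 * a 1)))]
  have h4 := le_of_mul_le_mul_left h3 pi_pos
  have h5 : π * η ≤ 4 * η := mul_le_mul_of_nonneg_right pi_le_four hη0
  linarith
end

lemma abs_exp_sub_quadratic_le {t : ℝ} (ht : |t| ≤ 1) :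
    |exp t - 1 - t - t ^ 2 / 2| ≤ |t| ^ 3 := by
  have h := Real.exp_bound ht (n := 3) (by norm_num)
  simp [Finset.sum_range_succ, Nat.factorial] at h
  rw [show exp t - 1 - t - t ^ 2 / 2 = exp t - (1 + t + t ^ 2 / 2) by ring]
  refine h.trans (mul_le_of_le_one_right (by positivity) (by norm_num))

lemma sphereLaplacian_eq_laplacian (w : EuclideanSpace ℝ (Fin 3) → ℝ)
    (x : EuclideanSpace ℝ (Fin 3)) :
    sphereLaplacian w x = Laplacian.laplacian (fun y => w (‖y‖⁻¹ • y)) x := by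
  rw [InnerProductSpace.laplacian_eq_iteratedFDeriv_orthonormalBasis _
    (EuclideanSpace.basisFun (Fin 3) ℝ)]
  simp [sphereLaplacian]

/-- There is a universal constant `ε₀ > 0` such that any smooth solution of
`Δ w = 6 - 6 e^w` on the round sphere with `|w|_{C⁰} < ε₀` vanishes
identically. -/
theorem stmt_16 :
    ∃ ε₀ : ℝ, 0 < ε₀ ∧ ∀ w : EuclideanSpace ℝ (Fin 3) → ℝ,
      ContDiffOn ℝ (⊤ : ℕ∞) (fun y => w (‖y‖⁻¹ • y)) {y | y ≠ 0} →
      (∀ x, ‖x‖ = 1 → sphereLaplacian w x = 6 - 6 * Real.exp (w x)) →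
      (∀ x, ‖x‖ = 1 → |w x| < ε₀) →
      ∀ x, ‖x‖ = 1 → w x = 0 := by
  obtain ⟨κ, hκ, happrox⟩ := exists_quadratic_approx (EuclideanSpace ℝ (Fin 3)) (by simp)
  refine ⟨1 / (1 + 12 * κ + 72 * (6 + 36 * κ + 108 * κ ^ 2)), by positivity,
    fun w hw hpde hsmall => ?_⟩
  set W : EuclideanSpace ℝ (Fin 3) → ℝ := fun y => w (‖y‖⁻¹ • y) with hWdef
  have hWw : ∀ y, ‖y‖ = 1 → W y = w y := fun y hy => by simp [hWdef, hy]
  have hW : ContDiffOn ℝ 2 W {y | y ≠ 0} := hw.of_le (WithTop.coe_le_coe.2 (le_top : (2 : ℕ∞) ≤ ⊤))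
  have hom : ∀ t : ℝ, 0 < t → ∀ y, W (t • y) = W y := fun t ht y => by
    simp only [hWdef, norm_smul, norm_eq_abs, abs_of_pos ht, smul_smul]
    congr 2
    field_simp
  obtain ⟨x₀, hx₀, hmax₀⟩ := (isCompact_sphere (0 : EuclideanSpace ℝ (Fin 3)) 1).exists_isMaxOn
    (NormedSpace.sphere_nonempty.2 zero_le_one) (f := fun y => |W y|)
    ((hW.continuousOn.mono fun y hy => ne_zero_of_mem_unit_sphere ⟨y, hy⟩).abs)
  rw [mem_sphere_zero_iff_norm] at hx₀
  set s : ℝ := |W x₀| with hs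
  have hs0 : 0 ≤ s := abs_nonneg _
  have hWs : ∀ y, ‖y‖ = 1 → |W y| ≤ s := fun y hy =>
    hmax₀ (mem_sphere_zero_iff_norm.2 hy)
  have hsε : s * (1 + 12 * κ + 72 * (6 + 36 * κ + 108 * κ ^ 2)) < 1 := by
    have := hsmall x₀ hx₀
    rwa [← hWw x₀ hx₀, lt_div_iff₀ (by positivity)] at this
  have hsκ : 0 ≤ s * κ := by positivity
  have hsκ2 : 0 ≤ s * κ ^ 2 := by positivity
  have hs1 : s ≤ 1 := by linarith
  set f : EuclideanSpace ℝ (Fin 3) → ℝ := fun y => 6 * (1 + W y - exp (W y)) with hfdef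
  have hf : ContinuousOn f {y | y ≠ 0} := by
    have := hW.continuousOn
    simp only [hfdef]
    fun_prop
  have pde : ∀ y, ‖y‖ = 1 → Laplacian.laplacian W y + 6 * W y = f y := fun y hy => by
    rw [← sphereLaplacian_eq_laplacian, hpde y hy, hfdef, ← hWw y hy]
    ring
  have hδ : ∀ y, ‖y‖ = 1 → |f y| ≤ 6 * s ^ 2 := fun y hy => by
    have h1 := Real.abs_exp_sub_one_sub_id_le ((hWs y hy).trans hs1)
    rw [show f y = -(6 * (exp (W y) - 1 - W y)) by simp only [hfdef]; ring, abs_neg, abs_mul,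
      abs_of_pos (by norm_num : (0 : ℝ) < 6)]
    have h2 : W y ^ 2 ≤ s ^ 2 := sq_le_sq' (abs_le.1 (hWs y hy)).1 (abs_le.1 (hWs y hy)).2
    linarith
  have hC : ∀ y, |W y| ≤ max s |W 0| := fun y => by
    rcases eq_or_ne y 0 with rfl | hy
    · exact le_max_right _ _
    · rw [← hom ‖y‖⁻¹ (by positivity) y]
      exact (hWs _ (by simp [norm_smul, hy])).trans (le_max_left _ _)
  obtain ⟨b, a, ha, hmax, hclose⟩ := happrox W f (6 * s ^ 2) _ hW hom hf pde hδ hC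
  have hη : ∀ y, ‖y‖ = 1 → |f y + 3 * (∑ i, a i * inner ℝ (b i) y ^ 2) ^ 2| ≤
      s ^ 3 * (6 + 36 * κ + 108 * κ ^ 2) := fun y hy => by
    set q : ℝ := ∑ i, a i * inner ℝ (b i) y ^ 2
    have h1 := abs_exp_sub_quadratic_le ((hWs y hy).trans hs1)
    have h2 : |W y| ^ 3 ≤ s ^ 3 := pow_le_pow_left₀ (abs_nonneg _) (hWs y hy) 3
    have h3 := hclose y hy
    have h4 : |W y + q| ≤ 2 * s + κ * (6 * s ^ 2) := by
      have := hWs y hy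
      rw [abs_le] at this h3 ⊢
      constructor <;> linarith [this.1, this.2, h3.1, h3.2]
    have h5 : |(W y - q) * (W y + q)| ≤ κ * (6 * s ^ 2) * (2 * s + κ * (6 * s ^ 2)) := by
      rw [abs_mul]
      exact mul_le_mul h3 h4 (abs_nonneg _) (by positivity)
    have h6 : κ * (6 * s ^ 2) * (2 * s + κ * (6 * s ^ 2)) ≤ s ^ 3 * (12 * κ + 36 * κ ^ 2) := by
      have : s ^ 3 * κ ^ 2 * s ≤ s ^ 3 * κ ^ 2 * 1 := by gcongr
      linarith
    rw [show f y + 3 * q ^ 2 = -(6 * (exp (W y) - 1 - W y - W y ^ 2 / 2)) -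
      3 * ((W y - q) * (W y + q)) by simp only [hfdef]; ring]
    have h7 := h1.trans h2
    have h8 := h5.trans h6
    rw [abs_le] at h7 h8 ⊢
    constructor <;> linarith [h7.1, h7.2, h8.1, h8.2]
  have hsq := sq_le_of_abs_add_three_mul_sq_le hW hom hf pde b ha hmax hη
  have hsa : s ≤ 2 * |a 2| := by
    have h1 := hclose x₀ hx₀
    have h2 := abs_sum_mul_inner_sq_le b hmax hx₀
    have h3 : s ≤ |a 2| + κ * (6 * s ^ 2) := by
      have := abs_sub_abs_le_abs_sub (W x₀) (∑ i, a i * inner ℝ (b i) x₀ ^ 2)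
      linarith
    have h4 : s * (s * κ * 12) ≤ s * 1 := by
      gcongr
      linarith
    linarith
  have hs_sq : s ^ 2 ≤ 4 * a 2 ^ 2 := by
    have := pow_le_pow_left₀ hs0 hsa 2
    rwa [mul_pow, sq_abs (a 2), show (2 : ℝ) ^ 2 = 4 by norm_num] at this
  have hszero : s = 0 := by
    by_contra hne
    have hpos : 0 < s := lt_of_le_of_ne hs0 (Ne.symm hne)
    have h1 : s ^ 2 * 1 ≤ s ^ 2 * (s * (72 * (6 + 36 * κ + 108 * κ ^ 2))) := by linarith
    have h2 := le_of_mul_le_mul_left h1 (by positivity)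
    linarith
  intro x hx
  have h := hWs x hx
  rw [hszero, hWw x hx] at h
  exact abs_nonpos_iff.1 h
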